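/- Let $n \geq 1$ be an integer and let $a_1, \dots, a_n$ be positive integers with $s = a_1 + \cdots + a_n$ (so $s \geq n$). Then $$\frac{\prod_{j=1}^{n}(2a_j + 1)^3}{3^{s}} \;\leq\; \left(\frac{27\,(s/n)^3}{3^{s/n}}\right)^{n},$$ where $3^{s/n}$ denotes the real power $\exp\left(\frac{s}{n}\log 3\right)$. -/

import Mathlib

theorem ratio_bound (n : ℕ) (hn : 1 ≤ n) (a : Fin n → ℕ) (ha : ∀ j, 1 ≤ a j)
    (s : ℕ) (hs : s = ∑ j, a j) :
    (∏ j, (2 * (a j : ℝ) + 1) ^ 3) / 3 ^ s ≤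
      (27 * ((s : ℝ) / n) ^ 3 / (3 : ℝ) ^ ((s : ℝ) / (n : ℝ))) ^ n := by
  have hn0 : (0 : ℝ) < n := by exact_mod_cast hn
  have hns : (n : ℝ) ≤ s := by
    have h : ∑ j : Fin n, 1 ≤ ∑ j, a j := Finset.sum_le_sum fun j _ => ha j
    simp only [Finset.sum_const, Finset.card_univ, Fintype.card_fin, smul_eq_mul, mul_one] at h
    rw [hs]
    exact_mod_cast h
  have hsR : (∑ j, (a j : ℝ)) = s := by rw [hs]; push_cast; rfl
  have hP0 : 0 ≤ ∏ j, (2 * (a j : ℝ) + 1) := Finset.prod_nonneg fun j _ => by positivity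
  have hP : ∏ j, (2 * (a j : ℝ) + 1) ≤ (3 * ((s : ℝ) / n)) ^ n := by
    have h := Real.geom_mean_le_arith_mean Finset.univ (fun _ : Fin n => (1 : ℝ))
      (fun j => 2 * (a j : ℝ) + 1) (fun _ _ => zero_le_one) (by simpa using hn0)
      (fun j _ => by positivity)
    simp only [Real.rpow_one, one_mul, Finset.sum_add_distrib, ← Finset.mul_sum, hsR,
      Finset.sum_const, Finset.card_univ, Fintype.card_fin, nsmul_eq_mul, mul_one] at h
    have h2 : (2 * (s : ℝ) + n) / n ≤ 3 * ((s : ℝ) / n) := by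
      rw [← mul_div_assoc]
      gcongr
      linarith
    have h3 := pow_le_pow_left₀ (by positivity) (h.trans h2) n
    rwa [Real.rpow_inv_natCast_pow hP0 (by omega)] at h3
  have hd : ((3 : ℝ) ^ ((s : ℝ) / (n : ℝ))) ^ n = 3 ^ s := by
    rw [← Real.rpow_natCast, ← Real.rpow_mul (by norm_num), div_mul_cancel₀ _ hn0.ne',
      Real.rpow_natCast]
  rw [div_pow, hd, Finset.prod_pow]
  have h27 : (27 * ((s : ℝ) / n) ^ 3) ^ n = ((3 * ((s : ℝ) / n)) ^ n) ^ 3 := by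
    rw [← pow_mul, mul_comm n 3, pow_mul]
    congr 1
    ring
  rw [h27]
  gcongr
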